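/- Let n ≥ 3 and let σ be a nonnegative Borel measure on ℝⁿ, finite on bounded sets, with W_Gσ(x) < ∞ for every x ∈ ℝⁿ. If u : ℝⁿ → [0,∞] is Borel with σ({x : u(x) > 0}) > 0, ∫_{ℝⁿ} F(u) dσ < ∞, and u(x) = W_G((f∘u)·dσ)(x) for every x ∈ ℝⁿ, then ∫_{ℝⁿ} F((W_Gσ)^(1/(1−γ))) dσ < ∞. -/

import Mathlib

open MeasureTheory Metric Set
open scoped ENNReal

noncomputable def gfun (p q : ℝ) (t : ℝ≥0∞) : ℝ≥0∞ := t ^ (p - 1) + t ^ (q - 1)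

noncomputable def ffun (p q γ : ℝ) (t : ℝ≥0∞) : ℝ≥0∞ :=
  t ^ ((p - 1) * γ) + t ^ ((q - 1) * γ)

noncomputable def Ffun (p q γ : ℝ) (t : ℝ≥0∞) : ℝ≥0∞ :=
  t ^ ((p - 1) * γ + 1) / ENNReal.ofReal ((p - 1) * γ + 1)
    + t ^ ((q - 1) * γ + 1) / ENNReal.ofReal ((q - 1) * γ + 1)

/-- The Wolff-type potential `W_G σ(x) = ∫₀^∞ h(σ(B(x,t))/t^(n−1)) dt`,
where `h` is the inverse of `g`. -/
noncomputable def wolffG (n : ℕ) (h : ℝ≥0∞ → ℝ≥0∞)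
    (σ : Measure (EuclideanSpace ℝ (Fin n))) (x : EuclideanSpace ℝ (Fin n)) : ℝ≥0∞ :=
  ∫⁻ t in Set.Ioi (0 : ℝ), h (σ (ball x t) / ENNReal.ofReal t ^ (n - 1))

/-- The classical Wolff potential `W_s σ(x) = ∫₀^∞ (σ(B(x,t))/t^(n−1))^(1/(s−1)) dt`. -/
noncomputable def wolffS (n : ℕ) (s : ℝ)
    (σ : Measure (EuclideanSpace ℝ (Fin n))) (x : EuclideanSpace ℝ (Fin n)) : ℝ≥0∞ :=
  ∫⁻ t in Set.Ioi (0 : ℝ), (σ (ball x t) / ENNReal.ofReal t ^ (n - 1)) ^ (1 / (s - 1))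

/-- Condition (A) on the measure σ. -/
def condA (n : ℕ) (p q γ : ℝ) (σ : Measure (EuclideanSpace ℝ (Fin n))) : Prop :=
  ∀ s ∈ ({p, q} : Set ℝ),
    ∀ θ ∈ ({1 / (1 - γ), (p - 1) / (p - 1 - γ * (q - 1)),
            (q - 1) / (q - 1 - γ * (p - 1))} : Set ℝ),
      (∫⁻ x, Ffun p q γ ((wolffS n s σ x) ^ θ) ∂σ) < ⊤

section WolffLowerBound

variable {p q γ : ℝ}

lemma gfun_mono (hp : 1 < p) (hq : 1 < q) : Monotone (gfun p q) := by
  intro a b hab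
  unfold gfun
  gcongr

lemma gfun_mul_le (hp : 1 < p) (hq : 1 < q) (a b : ℝ≥0∞) :
    gfun p q (a * b) ≤ gfun p q a * gfun p q b := by
  unfold gfun
  rw [ENNReal.mul_rpow_of_nonneg _ _ (by linarith), ENNReal.mul_rpow_of_nonneg _ _ (by linarith),
    add_mul, mul_add, mul_add]
  exact add_le_add le_self_add le_add_self

lemma gfun_zero (hp : 1 < p) (hq : 1 < q) : gfun p q 0 = 0 := by
  simp [gfun, ENNReal.zero_rpow_of_pos (sub_pos.2 hp), ENNReal.zero_rpow_of_pos (sub_pos.2 hq)]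

lemma ffun_eq_gfun_rpow (t : ℝ≥0∞) : ffun p q γ t = gfun p q (t ^ γ) := by
  simp only [ffun, gfun, ← ENNReal.rpow_mul, mul_comm γ]

section Inverse

variable {h : ℝ≥0∞ → ℝ≥0∞}

lemma inverse_gfun_mono (hp : 1 < p) (hq : 1 < q)
    (hhg : ∀ s, gfun p q (h s) = s) : Monotone h := by
  intro s s' hs
  by_contra! hlt
  have := gfun_mono hp hq hlt.le
  rw [hhg, hhg] at this
  exact hlt.ne' (by rw [le_antisymm hs this])

lemma inverse_gfun_ne_zero (hp : 1 < p) (hq : 1 < q)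
    (hhg : ∀ s, gfun p q (h s) = s) {s : ℝ≥0∞} (hs : s ≠ 0) : h s ≠ 0 := by
  intro h0
  exact hs (by rw [← hhg s, h0, gfun_zero hp hq])

lemma mul_inverse_gfun_le (hp : 1 < p) (hq : 1 < q)
    (hgh : ∀ t, h (gfun p q t) = t) (hhg : ∀ s, gfun p q (h s) = s)
    (a b : ℝ≥0∞) : h a * h b ≤ h (a * b) := by
  have := inverse_gfun_mono hp hq hhg (gfun_mul_le hp hq (h a) (h b))
  rwa [hgh, hhg, hhg] at this

lemma inverse_gfun_le_one (hp : 1 < p) (hq : 1 < q)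
    (hgh : ∀ t, h (gfun p q t) = t) (hhg : ∀ s, gfun p q (h s) = s)
    {s : ℝ≥0∞} (hs : s ≤ 1) : h s ≤ 1 := by
  have h2 : s ≤ gfun p q 1 := by simpa [gfun] using hs.trans le_self_add
  simpa [hgh] using inverse_gfun_mono hp hq hhg h2

end Inverse

/-- A finite density on the half-line has a point splitting its mass into two halves. -/
lemma exists_lintegral_Ioc_Ioi_half {φ : ℝ → ℝ≥0∞} (hφ : Measurable φ)
    (hfin : ∫⁻ t in Ioi (0 : ℝ), φ t ≠ ⊤) :
    ∃ t₀ : ℝ, 0 ≤ t₀ ∧ (∫⁻ t in Ioi (0 : ℝ), φ t) / 2 ≤ ∫⁻ t in Ioc 0 t₀, φ t ∧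
      (∫⁻ t in Ioi (0 : ℝ), φ t) / 2 ≤ ∫⁻ t in Ioi t₀, φ t := by
  set I := ∫⁻ t in Ioi (0 : ℝ), φ t with hI
  rcases eq_or_ne I 0 with h0 | h0
  · exact ⟨0, le_rfl, by simp [h0], by simp [h0]⟩
  have hint : IntegrableOn (fun t => (φ t).toReal) (Ioi 0) :=
    integrable_toReal_of_lintegral_ne_top hφ.aemeasurable hfin
  have hae : ∀ᵐ t ∂volume.restrict (Ioi (0 : ℝ)), φ t < ⊤ := ae_lt_top hφ hfin
  have key : ∀ T, 0 ≤ T → ∫ t in (0 : ℝ)..T, (φ t).toReal = (∫⁻ t in Ioc 0 T, φ t).toReal := by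
    intro T hT
    rw [intervalIntegral.integral_of_le hT, integral_toReal hφ.aemeasurable]
    exact ae_restrict_of_ae_restrict_of_subset Ioc_subset_Ioi_self hae
  have hlim := intervalIntegral_tendsto_integral_Ioi 0 hint Filter.tendsto_id
  rw [integral_toReal hφ.aemeasurable hae, ← hI] at hlim
  have hIpos : 0 < I.toReal := ENNReal.toReal_pos h0 hfin
  obtain ⟨T, hT, hT0⟩ := ((hlim.eventually (lt_mem_nhds (half_lt_self hIpos))).and
    (Filter.eventually_ge_atTop 0)).exists
  have hcont : ContinuousOn (fun s => ∫ t in (0 : ℝ)..s, (φ t).toReal) (Icc 0 T) := by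
    rw [← uIcc_of_le hT0]
    apply intervalIntegral.continuousOn_primitive_interval
    rw [uIcc_of_le hT0, integrableOn_Icc_iff_integrableOn_Ioc]
    exact hint.mono_set Ioc_subset_Ioi_self
  obtain ⟨t₀, ht₀, hval⟩ := intermediate_value_Icc hT0 hcont
    (show I.toReal / 2 ∈ _ from ⟨by simp; positivity, hT.le⟩)
  have hsplit : I = (∫⁻ t in Ioc 0 t₀, φ t) + ∫⁻ t in Ioi t₀, φ t := by
    rw [hI, ← Ioc_union_Ioi_eq_Ioi ht₀.1, lintegral_union measurableSet_Ioi]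
    exact Set.disjoint_left.2 fun t h1 h2 => not_lt.2 h1.2 h2
  have hne : ∫⁻ t in Ioc 0 t₀, φ t ≠ ⊤ := fun e => hfin (by rw [hsplit, e, top_add])
  have hhalf : ∫⁻ t in Ioc 0 t₀, φ t = I / 2 := by
    rw [← ENNReal.toReal_eq_toReal_iff' hne (ENNReal.div_ne_top hfin (by simp)), ← key t₀ ht₀.1]
    simpa using hval
  refine ⟨t₀, ht₀.1, hhalf.ge, ?_⟩
  have h2 : I / 2 + I / 2 ≤ I / 2 + ∫⁻ t in Ioi t₀, φ t := by
    rw [ENNReal.add_halves]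
    exact hhalf ▸ hsplit.le
  exact (ENNReal.add_le_add_iff_left (ENNReal.div_ne_top hfin (by simp))).1 h2

lemma measurable_measure_ball {X : Type*} [PseudoMetricSpace X] [MeasurableSpace X]
    (μ : Measure X) (x : X) : Measurable fun t : ℝ => μ (ball x t) :=
  (show Monotone fun t : ℝ => μ (ball x t) from
    fun _ _ hst => measure_mono (ball_subset_ball hst)).measurable

lemma setLIntegral_Ioi_comp_mul_left {a : ℝ} (ha : 0 < a) (t₀ : ℝ) (φ : ℝ → ℝ≥0∞) :
    ∫⁻ s in Ioi (a * t₀), φ s = ENNReal.ofReal a * ∫⁻ t in Ioi t₀, φ (a * t) := by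
  have himg : (fun t => a * t) '' Ioi t₀ = Ioi (a * t₀) := by
    simpa using Set.image_mul_left_Ioi ha t₀
  rw [← himg, lintegral_image_eq_lintegral_abs_deriv_mul measurableSet_Ioi (f' := fun _ => a)
    (fun t _ => by simpa using ((hasDerivAt_id t).const_mul a).hasDerivWithinAt)
    (fun s _ t _ hst => mul_left_cancel₀ ha.ne' hst), abs_of_pos ha,
    lintegral_const_mul' _ _ ENNReal.ofReal_ne_top]

section Potential

variable {n : ℕ} {h : ℝ≥0∞ → ℝ≥0∞}

lemma wolffG_mono (hh : Monotone h) {μ ν : Measure (EuclideanSpace ℝ (Fin n))} (hμν : μ ≤ ν)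
    (x : EuclideanSpace ℝ (Fin n)) : wolffG n h μ x ≤ wolffG n h ν x :=
  lintegral_mono fun _ => hh (ENNReal.div_le_div_right (hμν _) _)

lemma measurable_wolffG_integrand (hh : Monotone h) (μ : Measure (EuclideanSpace ℝ (Fin n)))
    (x : EuclideanSpace ℝ (Fin n)) :
    Measurable fun t : ℝ => h (μ (ball x t) / ENNReal.ofReal t ^ (n - 1)) :=
  hh.measurable.comp ((measurable_measure_ball μ x).div (ENNReal.measurable_ofReal.pow_const _))

/-- The potential at `y` dominates the tail of the potential at a nearby point `x`. -/
lemma tail_le_wolffG (hh : Monotone h) (hmul : ∀ a b, h a * h b ≤ h (a * b))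
    (μ : Measure (EuclideanSpace ℝ (Fin n))) {x y : EuclideanSpace ℝ (Fin n)} {t₀ : ℝ}
    (ht₀ : 0 ≤ t₀) (hy : dist y x < t₀) (hc : h ((2 ^ (n - 1))⁻¹) ≠ ⊤) :
    h ((2 ^ (n - 1))⁻¹) * ∫⁻ t in Ioi t₀, h (μ (ball x t) / ENNReal.ofReal t ^ (n - 1))
      ≤ wolffG n h μ y := by
  calc h ((2 ^ (n - 1))⁻¹) * ∫⁻ t in Ioi t₀, h (μ (ball x t) / ENNReal.ofReal t ^ (n - 1))
      = ∫⁻ t in Ioi t₀, h ((2 ^ (n - 1))⁻¹) *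
          h (μ (ball x t) / ENNReal.ofReal t ^ (n - 1)) :=
        (lintegral_const_mul' _ _ hc).symm
    _ ≤ ∫⁻ t in Ioi t₀, h (μ (ball y (2 * t)) / ENNReal.ofReal (2 * t) ^ (n - 1)) := by
        refine setLIntegral_mono' measurableSet_Ioi fun t ht => (hmul _ _).trans (hh ?_)
        have hball : ball x t ⊆ ball y (2 * t) := by
          apply ball_subset_ball'
          rw [dist_comm]
          linarith [mem_Ioi.1 ht]
        rw [ENNReal.ofReal_mul zero_le_two, mul_pow, ENNReal.ofReal_ofNat, div_eq_mul_inv,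
          div_eq_mul_inv, ENNReal.mul_inv (Or.inl (by simp)) (Or.inl (by simp)), mul_left_comm]
        gcongr
    _ ≤ ENNReal.ofReal 2 *
          ∫⁻ t in Ioi t₀, h (μ (ball y (2 * t)) / ENNReal.ofReal (2 * t) ^ (n - 1)) := by
        exact le_mul_of_one_le_left' (by simp)
    _ = ∫⁻ s in Ioi (2 * t₀), h (μ (ball y s) / ENNReal.ofReal s ^ (n - 1)) :=
        (setLIntegral_Ioi_comp_mul_left two_pos t₀
          fun s => h (μ (ball y s) / ENNReal.ofReal s ^ (n - 1))).symm
    _ ≤ wolffG n h μ y := lintegral_mono_set (Ioi_subset_Ioi (by positivity))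

/-- Restricting a measure to larger and larger balls recovers its potential. -/
lemma tendsto_wolffG_restrict_ball (hh : Monotone h) (σ : Measure (EuclideanSpace ℝ (Fin n)))
    (x : EuclideanSpace ℝ (Fin n)) :
    Filter.Tendsto (fun N : ℕ => wolffG n h (σ.restrict (ball 0 N)) x) Filter.atTop
      (nhds (wolffG n h σ x)) := by
  apply lintegral_tendsto_of_tendsto_of_monotone
  · exact fun N => (measurable_wolffG_integrand hh _ x).aemeasurable
  · refine Filter.Eventually.of_forall fun t N M hNM => hh (ENNReal.div_le_div_right ?_ _)
    exact Measure.restrict_mono_set σ (ball_subset_ball (Nat.cast_le.2 hNM)) _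
  · refine Filter.Eventually.of_forall fun t => tendsto_const_nhds.congr' ?_
    filter_upwards [Filter.eventually_ge_atTop ⌈t + dist x 0⌉₊] with N hN
    rw [Measure.restrict_eq_self]
    exact ball_subset_ball' (Nat.ceil_le.1 hN)

/-- The potential of a measure charging a ball is bounded below on bounded sets. -/
lemma exists_pos_le_wolffG (hh : Monotone h) (hpos : ∀ s ≠ 0, h s ≠ 0)
    {μ : Measure (EuclideanSpace ℝ (Fin n))} (hμ : μ ≠ 0) (R : ℕ) :
    ∃ A : ℝ≥0∞, A ≠ 0 ∧ A ≠ ⊤ ∧ ∀ x ∈ ball 0 (R : ℝ), A ≤ wolffG n h μ x := by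
  obtain ⟨N, hN⟩ : ∃ N : ℕ, μ (ball 0 (N : ℝ)) ≠ 0 := by
    by_contra! hall
    apply hμ
    rw [← Measure.measure_univ_eq_zero, ← iUnion_ball_nat (0 : EuclideanSpace ℝ (Fin n))]
    exact measure_iUnion_null hall
  have hd : μ (ball 0 (N : ℝ)) / ENNReal.ofReal (R + N + 1) ^ (n - 1) ≠ 0 :=
    ENNReal.div_ne_zero.2 ⟨hN, by simp⟩
  refine ⟨min 1 (h (μ (ball 0 (N : ℝ)) / ENNReal.ofReal (R + N + 1) ^ (n - 1))), ?_, by simp, ?_⟩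
  · rw [← pos_iff_ne_zero]
    exact lt_min one_pos (pos_iff_ne_zero.2 (hpos _ hd))
  intro x hx
  refine (min_le_right _ _).trans ?_
  calc h (μ (ball 0 (N : ℝ)) / ENNReal.ofReal (R + N + 1) ^ (n - 1))
      = ∫⁻ _ in Ioc (R + N : ℝ) (R + N + 1),
          h (μ (ball 0 (N : ℝ)) / ENNReal.ofReal (R + N + 1) ^ (n - 1)) := by simp
    _ ≤ ∫⁻ t in Ioc (R + N : ℝ) (R + N + 1), h (μ (ball x t) / ENNReal.ofReal t ^ (n - 1)) := by
        refine setLIntegral_mono' measurableSet_Ioc fun t ht => hh ?_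
        gcongr
        · apply ball_subset_ball'
          rw [dist_comm]
          linarith [ht.1, mem_ball.1 hx]
        · exact ht.2
    _ ≤ wolffG n h μ x := by
        refine lintegral_mono_set fun t ht => ?_
        exact lt_of_le_of_lt (by positivity) ht.1

/-- A pointwise lower bound for a supersolution on `E` improves to a lower bound with a
larger power of the potential of `σ` restricted to `E`. -/
lemma supersolution_lower_bound_step (hp : 1 < p) (hq : 1 < q) (hγ0 : 0 < γ) (hγ1 : γ < 1)
    (hgh : ∀ t, h (gfun p q t) = t) (hhg : ∀ s, gfun p q (h s) = s)
    {σ : Measure (EuclideanSpace ℝ (Fin n))} {E : Set (EuclideanSpace ℝ (Fin n))}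
    (hE : MeasurableSet E) (hWfin : ∀ x, wolffG n h (σ.restrict E) x ≠ ⊤)
    {u : EuclideanSpace ℝ (Fin n) → ℝ≥0∞}
    (hsup : ∀ x, wolffG n h (σ.withDensity fun y => ffun p q γ (u y)) x ≤ u x)
    {B : ℝ≥0∞} {θ : ℝ} (hθ0 : 0 ≤ θ) (hθ : θ * γ + 1 ≤ 1 / (1 - γ))
    (hlow : ∀ y ∈ E, B * ((h ((2 ^ (n - 1))⁻¹) / 2) ^ (1 / (1 - γ)) *
      wolffG n h (σ.restrict E) y) ^ θ ≤ u y)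
    (x : EuclideanSpace ℝ (Fin n)) :
    B ^ γ * ((h ((2 ^ (n - 1))⁻¹) / 2) ^ (1 / (1 - γ)) *
      wolffG n h (σ.restrict E) x) ^ (θ * γ + 1) ≤ u x := by
  have hh := inverse_gfun_mono hp hq hhg
  have hmul := mul_inverse_gfun_le hp hq hgh hhg
  set c := h ((2 ^ (n - 1))⁻¹)
  have hc1 : c ≤ 1 := inverse_gfun_le_one hp hq hgh hhg
    (ENNReal.inv_le_one.2 (one_le_pow₀ (by norm_num)))
  have hctop : c ≠ ⊤ := ne_top_of_le_ne_top (by simp) hc1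
  set τ := 1 / (1 - γ)
  set κ := (c / 2) ^ τ with hκ
  set V := wolffG n h (σ.restrict E) x
  obtain ⟨t₀, ht₀, hlo, hhi⟩ := exists_lintegral_Ioc_Ioi_half
    (measurable_wolffG_integrand hh (σ.restrict E) x) (hWfin x)
  change V / 2 ≤ _ at hlo
  change V / 2 ≤ _ at hhi
  set b := (B * (κ * (c * (V / 2))) ^ θ) ^ γ with hb
  have hdens : ∀ y ∈ E ∩ ball x t₀, gfun p q b ≤ ffun p q γ (u y) := by
    rintro y ⟨hyE, hy⟩
    rw [ffun_eq_gfun_rpow]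
    apply gfun_mono hp hq
    rw [hb]
    gcongr
    refine le_trans ?_ (hlow y hyE)
    gcongr
    exact (mul_le_mul_right hhi c).trans (tail_le_wolffG hh hmul _ ht₀ hy hctop)
  have hmass : ∀ t ≤ t₀, gfun p q b * σ.restrict E (ball x t) ≤
      σ.withDensity (fun y => ffun p q γ (u y)) (ball x t) := by
    intro t ht
    rw [Measure.restrict_apply measurableSet_ball, withDensity_apply _ measurableSet_ball,
      ← setLIntegral_const]
    refine (setLIntegral_mono' (measurableSet_ball.inter hE) fun y hy =>
      hdens y ⟨hy.2, ball_subset_ball ht hy.1⟩).trans ?_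
    exact lintegral_mono_set inter_subset_left
  have hbV : b * (V / 2) ≤ u x := by
    calc b * (V / 2)
        ≤ b * ∫⁻ t in Ioc 0 t₀, h (σ.restrict E (ball x t) / ENNReal.ofReal t ^ (n - 1)) := by
          gcongr
      _ = ∫⁻ t in Ioc 0 t₀, b * h (σ.restrict E (ball x t) / ENNReal.ofReal t ^ (n - 1)) :=
          (lintegral_const_mul _ (measurable_wolffG_integrand hh _ x)).symm
      _ ≤ ∫⁻ t in Ioc 0 t₀, h (σ.withDensity (fun y => ffun p q γ (u y)) (ball x t) /
            ENNReal.ofReal t ^ (n - 1)) := by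
          refine setLIntegral_mono' measurableSet_Ioc fun t ht => ?_
          have := hmul (gfun p q b) (σ.restrict E (ball x t) / ENNReal.ofReal t ^ (n - 1))
          rw [hgh] at this
          refine this.trans (hh ?_)
          rw [← mul_div_assoc]
          exact ENNReal.div_le_div_right (hmass t ht.2) _
      _ ≤ wolffG n h (σ.withDensity fun y => ffun p q γ (u y)) x :=
          lintegral_mono_set Ioc_subset_Ioi_self
      _ ≤ u x := hsup x
  refine le_trans ?_ hbV
  have hθγ : 0 ≤ θ * γ := by positivity
  have hκc : κ ≤ c ^ (θ * γ) * (2⁻¹) ^ (θ * γ + 1) := by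
    rw [hκ, div_eq_mul_inv, ENNReal.mul_rpow_of_nonneg _ _ (by linarith)]
    exact mul_le_mul' (ENNReal.rpow_le_rpow_of_exponent_ge hc1 (by linarith))
      (ENNReal.rpow_le_rpow_of_exponent_ge (by simp) hθ)
  have hadd : ∀ z : ℝ≥0∞, z ^ (θ * γ + 1) = z ^ (θ * γ) * z := fun z => by
    rw [ENNReal.rpow_add_of_nonneg _ _ hθγ zero_le_one, ENNReal.rpow_one]
  calc B ^ γ * (κ * V) ^ (θ * γ + 1)
      = B ^ γ * (κ ^ (θ * γ) * κ * V ^ (θ * γ + 1)) := by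
        rw [ENNReal.mul_rpow_of_nonneg _ _ (by linarith), hadd κ]
    _ ≤ B ^ γ * (κ ^ (θ * γ) * (c ^ (θ * γ) * (2⁻¹) ^ (θ * γ + 1)) * V ^ (θ * γ + 1)) := by
        gcongr
    _ = b * (V / 2) := by
        rw [hb, ENNReal.mul_rpow_of_nonneg _ _ hγ0.le,
          ← ENNReal.rpow_mul (κ * (c * (V / 2))), ENNReal.mul_rpow_of_nonneg _ _ hθγ,
          ENNReal.mul_rpow_of_nonneg _ _ hθγ, div_eq_mul_inv,
          ENNReal.mul_rpow_of_nonneg _ _ hθγ, hadd, hadd]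
        ring

/-- A supersolution bounded below on `E` dominates a power of the potential of `σ`
restricted to `E`, with a constant independent of the initial lower bound. -/
lemma supersolution_lower_bound_restrict (hp : 1 < p) (hq : 1 < q) (hγ0 : 0 < γ) (hγ1 : γ < 1)
    (hgh : ∀ t, h (gfun p q t) = t) (hhg : ∀ s, gfun p q (h s) = s)
    {σ : Measure (EuclideanSpace ℝ (Fin n))} {E : Set (EuclideanSpace ℝ (Fin n))}
    (hE : MeasurableSet E) (hWfin : ∀ x, wolffG n h (σ.restrict E) x ≠ ⊤)
    {u : EuclideanSpace ℝ (Fin n) → ℝ≥0∞}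
    (hsup : ∀ x, wolffG n h (σ.withDensity fun y => ffun p q γ (u y)) x ≤ u x)
    {A : ℝ≥0∞} (hA0 : A ≠ 0) (hA : A ≠ ⊤) (hAu : ∀ y ∈ E, A ≤ u y)
    (x : EuclideanSpace ℝ (Fin n)) :
    ((h ((2 ^ (n - 1))⁻¹) / 2) ^ (1 / (1 - γ)) *
      wolffG n h (σ.restrict E) x) ^ (1 / (1 - γ)) ≤ u x := by
  have h1γ : 0 < 1 - γ := by linarith
  set κ := (h ((2 ^ (n - 1))⁻¹) / 2) ^ (1 / (1 - γ))
  have hiter : ∀ k : ℕ, (∀ y ∈ E, A ^ (γ ^ k) *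
      (κ * wolffG n h (σ.restrict E) y) ^ ((1 - γ ^ k) / (1 - γ)) ≤ u y) ∧
      A ^ (γ ^ (k + 1)) *
        (κ * wolffG n h (σ.restrict E) x) ^ ((1 - γ ^ (k + 1)) / (1 - γ)) ≤ u x := by
    have hstep : ∀ k : ℕ, (∀ y ∈ E, A ^ (γ ^ k) *
        (κ * wolffG n h (σ.restrict E) y) ^ ((1 - γ ^ k) / (1 - γ)) ≤ u y) → ∀ z,
        A ^ (γ ^ (k + 1)) *
          (κ * wolffG n h (σ.restrict E) z) ^ ((1 - γ ^ (k + 1)) / (1 - γ)) ≤ u z := by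
      intro k hk z
      have hexp : (1 - γ ^ k) / (1 - γ) * γ + 1 = (1 - γ ^ (k + 1)) / (1 - γ) := by
        field_simp
        ring
      have := supersolution_lower_bound_step hp hq hγ0 hγ1 hgh hhg hE hWfin hsup
        (div_nonneg (sub_nonneg.2 (pow_le_one₀ hγ0.le hγ1.le)) h1γ.le)
        (by rw [hexp]; gcongr; linarith [pow_pos hγ0 (k + 1)]) hk z
      rwa [hexp, ← ENNReal.rpow_mul, ← pow_succ] at this
    intro k
    induction k with
    | zero =>
      have h0 : ∀ y ∈ E, A ^ (γ ^ 0) *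
          (κ * wolffG n h (σ.restrict E) y) ^ ((1 - γ ^ 0) / (1 - γ)) ≤ u y := by
        simpa using hAu
      exact ⟨h0, hstep 0 h0 x⟩
    | succ k ih =>
      have h1 := fun y (_ : y ∈ E) => hstep k ih.1 y
      exact ⟨h1, hstep (k + 1) h1 x⟩
  have hκtop : κ * wolffG n h (σ.restrict E) x ≠ ⊤ := by
    refine ENNReal.mul_ne_top (ENNReal.rpow_ne_top_of_nonneg (by positivity)
      (ENNReal.div_ne_top (ne_top_of_le_ne_top ENNReal.one_ne_top ?_) (by simp))) (hWfin x)
    exact inverse_gfun_le_one hp hq hgh hhg (ENNReal.inv_le_one.2 (one_le_pow₀ (by norm_num)))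
  set X := κ * wolffG n h (σ.restrict E) x
  rcases eq_or_ne X 0 with hX0 | hX0
  · rw [hX0, ENNReal.zero_rpow_of_pos (by positivity)]
    exact zero_le
  have hγk : Filter.Tendsto (fun k : ℕ => γ ^ (k + 1)) Filter.atTop (nhds 0) :=
    (tendsto_pow_atTop_nhds_zero_of_lt_one hγ0.le hγ1).comp (Filter.tendsto_add_atTop_nat 1)
  have hcont : ∀ {z : ℝ≥0∞}, z ≠ 0 → z ≠ ⊤ → Continuous fun r : ℝ => z ^ r := by
    intro z hz0 hz
    lift z to NNReal using hz
    have hz0' : z ≠ 0 := by simpa using hz0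
    simp_rw [← ENNReal.coe_rpow_of_ne_zero hz0']
    exact ENNReal.continuous_coe.comp (continuous_iff_continuousAt.2 fun r =>
      (NNReal.continuousAt_rpow (Or.inl hz0')).comp
        (continuousAt_const.prodMk continuousAt_id))
  have hA1 : Filter.Tendsto (fun k : ℕ => A ^ (γ ^ (k + 1))) Filter.atTop (nhds 1) := by
    simpa [Function.comp_def] using ((hcont hA0 hA).tendsto 0).comp hγk
  have hX1 : Filter.Tendsto (fun k : ℕ => X ^ ((1 - γ ^ (k + 1)) / (1 - γ))) Filter.atTop
      (nhds (X ^ (1 / (1 - γ)))) := by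
    have := (hγk.const_sub 1).div_const (1 - γ)
    rw [sub_zero] at this
    exact ((hcont hX0 hκtop).tendsto _).comp this
  have := ENNReal.Tendsto.mul hA1 (Or.inl one_ne_zero) hX1 (Or.inr ENNReal.one_ne_top)
  rw [one_mul] at this
  exact le_of_tendsto' this fun k => (hiter k).2

/-- Every nontrivial supersolution dominates a power of the potential of `σ`. -/
lemma supersolution_lower_bound (hp : 1 < p) (hq : 1 < q) (hγ0 : 0 < γ) (hγ1 : γ < 1)
    (hgh : ∀ t, h (gfun p q t) = t) (hhg : ∀ s, gfun p q (h s) = s)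
    {σ : Measure (EuclideanSpace ℝ (Fin n))} (hWfin : ∀ x, wolffG n h σ x ≠ ⊤)
    {u : EuclideanSpace ℝ (Fin n) → ℝ≥0∞}
    (hsup : ∀ x, wolffG n h (σ.withDensity fun y => ffun p q γ (u y)) x ≤ u x)
    (hnt : (σ.withDensity fun y => ffun p q γ (u y)) ≠ 0) (x : EuclideanSpace ℝ (Fin n)) :
    ((h ((2 ^ (n - 1))⁻¹) / 2) ^ (1 / (1 - γ)) * wolffG n h σ x) ^ (1 / (1 - γ)) ≤ u x := by
  have hh := inverse_gfun_mono hp hq hhg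
  have htop : h ((2 ^ (n - 1))⁻¹) ≠ ⊤ := ne_top_of_le_ne_top (by simp)
    (inverse_gfun_le_one hp hq hgh hhg (ENNReal.inv_le_one.2 (one_le_pow₀ (by norm_num))))
  refine le_of_tendsto (((ENNReal.continuous_rpow_const.tendsto _).comp
    (ENNReal.Tendsto.const_mul (tendsto_wolffG_restrict_ball hh σ x) (Or.inr ?_))))
    (Filter.Eventually.of_forall fun N => ?_)
  · exact ENNReal.rpow_ne_top_of_nonneg (one_div_nonneg.2 (by linarith))
      (ENNReal.div_ne_top htop (by simp))
  obtain ⟨A, hA0, hA, hAu⟩ := exists_pos_le_wolffG hh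
    (fun _ => inverse_gfun_ne_zero hp hq hhg) hnt N
  exact supersolution_lower_bound_restrict hp hq hγ0 hγ1 hgh hhg measurableSet_ball
    (fun y => ne_top_of_le_ne_top (hWfin y) (wolffG_mono hh Measure.restrict_le_self y))
    hsup hA0 hA (fun y hy => (hAu y hy).trans (hsup y)) x

end Potential

/-- `F` grows at most polynomially under dilations. -/
lemma Ffun_mul_le (hp : 1 < p) (hq : 1 < q) (hγ0 : 0 < γ) (C t : ℝ≥0∞) :
    Ffun p q γ (C * t) ≤
      (C ^ ((p - 1) * γ + 1) + C ^ ((q - 1) * γ + 1)) * Ffun p q γ t := by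
  have hp' : 0 ≤ (p - 1) * γ + 1 := by nlinarith
  have hq' : 0 ≤ (q - 1) * γ + 1 := by nlinarith
  unfold Ffun
  rw [ENNReal.mul_rpow_of_nonneg _ _ hp', ENNReal.mul_rpow_of_nonneg _ _ hq',
    mul_div_assoc, mul_div_assoc, mul_add]
  gcongr
  · exact le_self_add
  · exact le_add_self

lemma Ffun_mono (hp : 1 < p) (hq : 1 < q) (hγ0 : 0 < γ) : Monotone (Ffun p q γ) := by
  intro s t hst
  unfold Ffun
  gcongr

end WolffLowerBound

/-- Theorem (necessary condition for existence of a nontrivial finite-energy solution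
to the Wolff integral equation). -/
theorem necessary_condition
    (n : ℕ) (hn : 3 ≤ n) (p q γ : ℝ) (hp : 1 < p) (hpq : p < q)
    (hγ0 : 0 < γ) (hγ : γ < min ((p - 1) / (q - 1)) (1 / (q - p)))
    (h : ℝ≥0∞ → ℝ≥0∞)
    (hgh : ∀ t, h (gfun p q t) = t) (hhg : ∀ s, gfun p q (h s) = s)
    (σ : Measure (EuclideanSpace ℝ (Fin n)))
    (hσfin : ∀ (x : EuclideanSpace ℝ (Fin n)) (r : ℝ), σ (ball x r) < ⊤)
    (hWfin : ∀ x, wolffG n h σ x < ⊤)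
    (u : EuclideanSpace ℝ (Fin n) → ℝ≥0∞) (hu : Measurable u)
    (hnt : 0 < σ {x | 0 < u x})
    (hF : (∫⁻ x, Ffun p q γ (u x) ∂σ) < ⊤)
    (heq : ∀ x, u x = wolffG n h (σ.withDensity fun y => ffun p q γ (u y)) x) :
    (∫⁻ x, Ffun p q γ ((wolffG n h σ x) ^ (1 / (1 - γ))) ∂σ) < ⊤ := by
  have hq : 1 < q := hp.trans hpq
  have hγ1 : γ < 1 := (hγ.trans_le (min_le_left _ _)).trans
    ((div_lt_one (by linarith)).2 (by linarith))
  have hnt' : (σ.withDensity fun y => ffun p q γ (u y)) ≠ 0 := by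
    have hmeas : Measurable fun y => ffun p q γ (u y) := by
      unfold ffun
      fun_prop
    rw [Ne, withDensity_eq_zero_iff hmeas.aemeasurable]
    intro hzero
    refine hnt.ne' (measure_mono_null (fun x (hx : 0 < u x) => ?_) hzero)
    have hne : u x ^ ((p - 1) * γ) ≠ 0 := by
      simp [ENNReal.rpow_eq_zero_iff, hx.ne', not_lt.2 (mul_pos (sub_pos.2 hp) hγ0).le]
    exact fun h0 => hne (add_eq_zero.1 h0).1
  set κ := (h ((2 ^ (n - 1))⁻¹) / 2) ^ (1 / (1 - γ))
  have hτ : 0 ≤ 1 / (1 - γ) := one_div_nonneg.2 (by linarith)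
  have hlow : ∀ x, κ ^ (1 / (1 - γ)) * wolffG n h σ x ^ (1 / (1 - γ)) ≤ u x := fun x => by
    rw [← ENNReal.mul_rpow_of_nonneg _ _ hτ]
    exact supersolution_lower_bound hp hq hγ0 hγ1 hgh hhg (fun x => (hWfin x).ne)
      (fun x => (heq x).ge) hnt' x
  have hc0 : h ((2 ^ (n - 1))⁻¹) ≠ 0 := inverse_gfun_ne_zero hp hq hhg (by simp)
  have hctop : h ((2 ^ (n - 1))⁻¹) ≠ ⊤ := ne_top_of_le_ne_top ENNReal.one_ne_top
    (inverse_gfun_le_one hp hq hgh hhg (ENNReal.inv_le_one.2 (one_le_pow₀ (by norm_num))))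
  have hpow : ∀ {z : ℝ≥0∞}, z ≠ 0 → z ≠ ⊤ → z ^ (1 / (1 - γ)) ≠ 0 ∧ z ^ (1 / (1 - γ)) ≠ ⊤ :=
    fun h0 h1 => ⟨(ENNReal.rpow_pos (pos_iff_ne_zero.2 h0) h1).ne',
      ENNReal.rpow_ne_top_of_nonneg hτ h1⟩
  obtain ⟨hκ0, hκtop⟩ := hpow (ENNReal.div_ne_zero.2 ⟨hc0, ENNReal.ofNat_ne_top⟩)
    (ENNReal.div_ne_top hctop two_ne_zero)
  obtain ⟨hK0, hKtop⟩ := hpow hκ0 hκtop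
  set K := κ ^ (1 / (1 - γ))
  have hKinv : K⁻¹ ≠ ⊤ := ENNReal.inv_ne_top.2 hK0
  calc ∫⁻ x, Ffun p q γ ((wolffG n h σ x) ^ (1 / (1 - γ))) ∂σ
      ≤ ∫⁻ x, (K⁻¹ ^ ((p - 1) * γ + 1) + K⁻¹ ^ ((q - 1) * γ + 1)) * Ffun p q γ (u x) ∂σ := by
        refine lintegral_mono fun x => ?_
        refine (Ffun_mono hp hq hγ0 ?_).trans (Ffun_mul_le hp hq hγ0 K⁻¹ (u x))
        rw [mul_comm, ← div_eq_mul_inv, ENNReal.le_div_iff_mul_le (Or.inl hK0) (Or.inl hKtop),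
          mul_comm]
        exact hlow x
    _ < ⊤ := by
        have hfin : K⁻¹ ^ ((p - 1) * γ + 1) + K⁻¹ ^ ((q - 1) * γ + 1) ≠ ⊤ :=
          ENNReal.add_ne_top.2 ⟨ENNReal.rpow_ne_top_of_nonneg (by nlinarith) hKinv,
            ENNReal.rpow_ne_top_of_nonneg (by nlinarith) hKinv⟩
        rw [lintegral_const_mul' _ _ hfin]
        exact ENNReal.mul_lt_top hfin.lt_top hF
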